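/- arXiv:2408.15515 — 2 statements merged into one kernel-verified Lean document; each statement's English description precedes it below -/
import Mathlib

section
/- Let a : Fin m → Fin N → (ZMod 2)² be a family of generator rows such that for every pair i, i' ∈ Fin m the number of anticommuting positions of (a i, a i') is even. Then the ordered product P = (1 + G (a 0)) * (1 + G (a 1)) * ⋯ * (1 + G (a (m-1))) satisfies P * P = (2^m : ℂ) • P. -/
open Matrix

/-- Pauli matrices indexed by GF(4) identified with (ZMod 2)². -/
noncomputable def pauli (a : ZMod 2 × ZMod 2) : Matrix (Fin 2) (Fin 2) ℂ :=
  if a = (0, 0) then 1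
  else if a = (1, 0) then !![0, 1; 1, 0]
  else if a = (0, 1) then !![0, -Complex.I; Complex.I, 0]
  else !![1, 0; 0, -1]

/-- The N-qubit Pauli word σ_{a 0} ⊗ ⋯ ⊗ σ_{a (N-1)}. -/
noncomputable def pauliWord {N : ℕ} (a : Fin N → ZMod 2 × ZMod 2) :
    Matrix (Fin N → Fin 2) (Fin N → Fin 2) ℂ :=
  Matrix.of fun x y => ∏ i, pauli (a i) (x i) (y i)

/-- The number of anticommuting positions of a pair of rows (a, b). -/
def anticommCount {N : ℕ} (a b : Fin N → ZMod 2 × ZMod 2) : ℕ :=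
  (Finset.univ.filter fun i => ¬(a i = 0 ∨ b i = 0 ∨ a i = b i)).card

theorem zmod_two_prod_cases (a : ZMod 2 × ZMod 2) :
    a = (0, 0) ∨ a = (1, 0) ∨ a = (0, 1) ∨ a = (1, 1) := by
  revert a
  decide

theorem pauli_zero_zero : pauli (0, 0) = !![1, 0; 0, 1] := by
  rw [pauli, if_pos rfl, Matrix.one_fin_two]

theorem pauli_one_zero : pauli (1, 0) = !![0, 1; 1, 0] := by
  simp [pauli]

theorem pauli_zero_one : pauli (0, 1) = !![0, -Complex.I; Complex.I, 0] := by
  simp [pauli]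

theorem pauli_one_one : pauli (1, 1) = !![1, 0; 0, -1] := by
  simp [pauli]

theorem pauli_mul_self (a : ZMod 2 × ZMod 2) : pauli a * pauli a = 1 := by
  rcases zmod_two_prod_cases a with rfl | rfl | rfl | rfl <;>
    simp [pauli_zero_zero, pauli_one_zero, pauli_zero_one, pauli_one_one, Matrix.one_fin_two]

/-- Two Pauli matrices commute up to a sign, which is `-1` exactly when they anticommute. -/
theorem pauli_mul_comm (a b : ZMod 2 × ZMod 2) :
    pauli a * pauli b =
      (if ¬(a = 0 ∨ b = 0 ∨ a = b) then (-1 : ℂ) else 1) • (pauli b * pauli a) := by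
  rcases zmod_two_prod_cases a with rfl | rfl | rfl | rfl <;>
    rcases zmod_two_prod_cases b with rfl | rfl | rfl | rfl <;>
    simp [pauli_zero_zero, pauli_one_zero, pauli_zero_one, pauli_one_one]

theorem pauliWord_mul_apply {N : ℕ} (a b : Fin N → ZMod 2 × ZMod 2) (x y : Fin N → Fin 2) :
    (pauliWord a * pauliWord b) x y = ∏ i, (pauli (a i) * pauli (b i)) (x i) (y i) := by
  simp only [Matrix.mul_apply, pauliWord, Matrix.of_apply, ← Finset.prod_mul_distrib]
  exact (Fintype.prod_sum fun i j => pauli (a i) (x i) j * pauli (b i) j (y i)).symm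

theorem pauliWord_mul_self {N : ℕ} (a : Fin N → ZMod 2 × ZMod 2) :
    pauliWord a * pauliWord a = 1 := by
  ext x y
  simp only [pauliWord_mul_apply, pauli_mul_self, Matrix.one_apply, Fintype.prod_ite_zero,
    Finset.prod_const_one, funext_iff]

theorem pauliWord_mul_comm {N : ℕ} (a b : Fin N → ZMod 2 × ZMod 2) :
    pauliWord a * pauliWord b = (-1 : ℂ) ^ anticommCount a b • (pauliWord b * pauliWord a) := by
  ext x y
  rw [Matrix.smul_apply, pauliWord_mul_apply, pauliWord_mul_apply, smul_eq_mul, anticommCount,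
    ← Finset.prod_const, Finset.prod_filter, ← Finset.prod_mul_distrib]
  refine Finset.prod_congr rfl fun i _ => ?_
  rw [pauli_mul_comm, Matrix.smul_apply, smul_eq_mul]

theorem commute_pauliWord {N : ℕ} {a b : Fin N → ZMod 2 × ZMod 2}
    (h : Even (anticommCount a b)) : Commute (pauliWord a) (pauliWord b) := by
  rw [commute_iff_eq, pauliWord_mul_comm, h.neg_one_pow, one_smul]

/-- If `x * x = c • x` for all members of a commuting list, then its product `p` satisfies
`p * p = c ^ n • p`, where `n` is the length of the list. -/
theorem List.prod_mul_self_eq_smul {R A : Type*} [CommSemiring R] [Semiring A] [Algebra R A]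
    {c : R} (l : List A) (hl : ∀ x ∈ l, x * x = c • x) (hcomm : ∀ x ∈ l, ∀ y ∈ l, Commute x y) :
    l.prod * l.prod = c ^ l.length • l.prod := by
  induction l with
  | nil => simp
  | cons x l ih =>
    have hx : Commute l.prod x := Commute.list_prod_left l x fun y hy =>
      hcomm y (List.mem_cons_of_mem x hy) x List.mem_cons_self
    have ih := ih (fun y hy => hl y (List.mem_cons_of_mem x hy)) fun y hy z hz =>
      hcomm y (List.mem_cons_of_mem x hy) z (List.mem_cons_of_mem x hz)
    rw [List.prod_cons, hx.mul_mul_mul_comm, hl x List.mem_cons_self, ih, smul_mul_smul_comm,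
      List.length_cons, pow_succ']

theorem stmt_5 (N m : ℕ) (hN : 1 ≤ N) (hm : 1 ≤ m)
    (a : Fin m → Fin N → ZMod 2 × ZMod 2)
    (hcomm : ∀ i i' : Fin m, Even (anticommCount (a i) (a i')))
    (P : Matrix (Fin N → Fin 2) (Fin N → Fin 2) ℂ)
    (hP : P = (List.ofFn fun i => 1 + pauliWord (a i)).prod) :
    P * P = (2 ^ m : ℂ) • P := by
  have key := List.prod_mul_self_eq_smul (c := (2 : ℂ))
    (List.ofFn fun i => 1 + pauliWord (a i)) ?_ ?_
  · rwa [List.length_ofFn, ← hP] at key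
  · simp only [List.forall_mem_ofFn_iff]
    intro i
    rw [mul_add, add_mul, add_mul, pauliWord_mul_self, two_smul]
    simp only [one_mul, mul_one]
    abel
  · simp only [List.forall_mem_ofFn_iff]
    intro i j
    exact (Commute.one_left _).add_left
      ((Commute.one_right _).add_right (commute_pauliWord (hcomm i j)))
end

section
/- Let k < N and let a : Fin m → Fin N → (ZMod 2)² satisfy: (a) for every pair i, i' ∈ Fin m the number of anticommuting positions of (a i, a i') is even; (b) for every ε : Fin m → ZMod 2 with ε ≠ 0, the row b_ε = ∑ i, ε i • a i is not the zero row; (c) for every ε ≠ 0, the number of coordinates j with b_ε j = 0 is at most N - k - 1. Then the state ρ = (2^N : ℂ)⁻¹ • ((1 + G (a 0)) * ⋯ * (1 + G (a (m-1)))) is k-uniform: for every S ⊆ Fin N with S.card = k, the reduced matrix ρ_S equals (2^k : ℂ)⁻¹ • 1. -/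
open Matrix

/-- Merge a function on S and a function on its complement into a function on Fin N. -/
def mergeFn {N d : ℕ} (S : Finset (Fin N)) (u : {j // j ∈ S} → Fin d)
    (w : {j // j ∉ S} → Fin d) : Fin N → Fin d :=
  fun j => if h : j ∈ S then u ⟨j, h⟩ else w ⟨j, h⟩

/-- The reduced matrix (partial trace over the complement of S). -/
noncomputable def reduceMatrix {N d : ℕ} (ρ : Matrix (Fin N → Fin d) (Fin N → Fin d) ℂ)
    (S : Finset (Fin N)) :
    Matrix ({j // j ∈ S} → Fin d) ({j // j ∈ S} → Fin d) ℂ :=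
  Matrix.of fun u v => ∑ w : {j // j ∉ S} → Fin d, ρ (mergeFn S u w) (mergeFn S v w)

theorem exists_pauli_mul_eq_smul (a b : ZMod 2 × ZMod 2) :
    ∃ c : ℂ, pauli a * pauli b = c • pauli (a + b) := by
  have hcases : ∀ a : ZMod 2 × ZMod 2, a = (0, 0) ∨ a = (1, 0) ∨ a = (0, 1) ∨ a = (1, 1) := by
    decide
  have h2 : (1 : ZMod 2) + 1 = 0 := rfl
  rcases hcases a with rfl | rfl | rfl | rfl <;> rcases hcases b with rfl | rfl | rfl | rfl <;>
    first
    | refine ⟨1, ?_⟩; simp [pauli, h2, Matrix.one_fin_two]; done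
    | refine ⟨Complex.I, ?_⟩; simp [pauli, h2]; done
    | refine ⟨-Complex.I, ?_⟩; simp [pauli, h2]

theorem trace_pauli_eq_zero {a : ZMod 2 × ZMod 2} (ha : a ≠ 0) : (pauli a).trace = 0 := by
  have h0 : a ≠ (0, 0) := ha
  rw [pauli, if_neg h0]
  split_ifs <;> simp [Matrix.trace_fin_two]

theorem exists_pauliWord_mul_eq_smul {N : ℕ} (a b : Fin N → ZMod 2 × ZMod 2) :
    ∃ c : ℂ, pauliWord a * pauliWord b = c • pauliWord (a + b) := by
  choose c hc using fun i => exists_pauli_mul_eq_smul (a i) (b i)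
  refine ⟨∏ i, c i, ?_⟩
  ext x y
  have hentry : ∀ i, ∑ z, pauli (a i) (x i) z * pauli (b i) z (y i) =
      c i * pauli (a i + b i) (x i) (y i) := fun i => by
    simpa [Matrix.mul_apply] using congrFun (congrFun (hc i) (x i)) (y i)
  simp only [Matrix.mul_apply, pauliWord, Matrix.of_apply, Matrix.smul_apply, smul_eq_mul,
    Pi.add_apply, ← Finset.prod_mul_distrib, ← hentry]
  rw [Finset.prod_univ_sum, Fintype.piFinset_univ]

/-- A product of factors `1 + pauliWord (a i)` differs from `1` by a combination of the Pauli words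
of the nontrivial sums of rows. -/
theorem prod_one_add_pauliWord_sub_one_mem_span {N : ℕ} :
    ∀ {m : ℕ} (a : Fin m → Fin N → ZMod 2 × ZMod 2),
      (List.ofFn fun i => 1 + pauliWord (a i)).prod - 1 ∈
        Submodule.span ℂ {M | ∃ ε : Fin m → ZMod 2, ε ≠ 0 ∧ M = pauliWord (∑ i, ε i • a i)}
  | 0, _ => by simp
  | m + 1, a => by
    have ih := prod_one_add_pauliWord_sub_one_mem_span fun i : Fin m => a i.succ
    rw [List.ofFn_succ, List.prod_cons]
    set P := (List.ofFn fun i : Fin m => 1 + pauliWord (a i.succ)).prod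
    set V := Submodule.span ℂ
      {M | ∃ ε : Fin (m + 1) → ZMod 2, ε ≠ 0 ∧ M = pauliWord (∑ i, ε i • a i)}
    have hcons : ∀ (t : ZMod 2) (ε : Fin m → ZMod 2), t ≠ 0 ∨ ε ≠ 0 →
        pauliWord (t • a 0 + ∑ i, ε i • a i.succ) ∈ V := fun t ε h => by
      refine Submodule.subset_span ⟨Fin.cons t ε, ?_, ?_⟩
      · rintro h0
        rcases h with h | h
        · exact h (by simpa using congrFun h0 0)
        · exact h (funext fun i => by simpa using congrFun h0 i.succ)
      · simp [Fin.sum_univ_succ]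
    have hsub : P - 1 ∈ V := by
      refine Submodule.span_le.2 ?_ ih
      rintro _ ⟨ε, hε, rfl⟩
      simpa using hcons 0 ε (Or.inr hε)
    have hmul : pauliWord (a 0) * (P - 1) ∈ V := by
      suffices h : Submodule.span ℂ _ ≤ V.comap (LinearMap.mulLeft ℂ (pauliWord (a 0))) from h ih
      refine Submodule.span_le.2 ?_
      rintro _ ⟨ε, hε, rfl⟩
      obtain ⟨c, hc⟩ := exists_pauliWord_mul_eq_smul (a 0) (∑ i, ε i • a i.succ)
      have h := V.smul_mem c (hcons 1 ε (Or.inr hε))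
      simpa [hc] using h
    have hword : pauliWord (a 0) ∈ V := by simpa using hcons 1 0 (Or.inl one_ne_zero)
    have hsum : (1 + pauliWord (a 0)) * P - 1 =
        (P - 1) + pauliWord (a 0) + pauliWord (a 0) * (P - 1) := by noncomm_ring
    rw [hsum]
    exact V.add_mem (V.add_mem hsub hword) hmul

/-- The partial trace as a linear map. -/
noncomputable def reduceMatrixLinear (N d : ℕ) (S : Finset (Fin N)) :
    Matrix (Fin N → Fin d) (Fin N → Fin d) ℂ →ₗ[ℂ]
      Matrix ({j // j ∈ S} → Fin d) ({j // j ∈ S} → Fin d) ℂ where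
  toFun ρ := reduceMatrix ρ S
  map_add' ρ τ := by
    ext u v
    simp [reduceMatrix, Finset.sum_add_distrib]
  map_smul' c ρ := by
    ext u v
    simp [reduceMatrix, Finset.mul_sum]

theorem reduceMatrix_pauliWord_eq_zero {N : ℕ} {b : Fin N → ZMod 2 × ZMod 2}
    {S : Finset (Fin N)} {j : Fin N} (hj : j ∉ S) (hb : b j ≠ 0) :
    reduceMatrix (pauliWord b) S = 0 := by
  ext u v
  have hsplit : ∀ w : {j // j ∉ S} → Fin 2,
      ∏ i, pauli (b i) (mergeFn S u w i) (mergeFn S v w i) =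
        (∏ i : {j // j ∈ S}, pauli (b i) (u i) (v i)) *
          ∏ i : {j // j ∉ S}, pauli (b i) (w i) (w i) := fun w => by
    rw [← Fintype.prod_subtype_mul_prod_subtype (· ∈ S)]
    congr 1
    · refine Finset.prod_congr (by ext; simp) fun i _ => ?_
      simp [mergeFn, i.2]
    · refine Finset.prod_congr rfl fun i _ => ?_
      simp only [mergeFn, dif_neg i.2]
  have htrace : ∑ w : {j // j ∉ S} → Fin 2, ∏ i : {j // j ∉ S}, pauli (b i) (w i) (w i) =
      ∏ i : {j // j ∉ S}, (pauli (b i)).trace := by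
    simp only [Matrix.trace, Matrix.diag_apply]
    rw [Finset.prod_univ_sum, Fintype.piFinset_univ]
  simp only [reduceMatrix, pauliWord, Matrix.of_apply, hsplit, ← Finset.mul_sum, htrace]
  rw [Finset.prod_eq_zero (Finset.mem_univ (⟨j, hj⟩ : {j // j ∉ S})) (trace_pauli_eq_zero hb)]
  simp

theorem mergeFn_left_inj {N d : ℕ} {S : Finset (Fin N)} {u v : {j // j ∈ S} → Fin d}
    {w : {j // j ∉ S} → Fin d} : mergeFn S u w = mergeFn S v w ↔ u = v := by
  refine ⟨fun h => funext fun i => ?_, fun h => h ▸ rfl⟩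
  simpa [mergeFn, i.2] using congrFun h i

theorem reduceMatrix_one {N d : ℕ} (S : Finset (Fin N)) :
    reduceMatrix (1 : Matrix (Fin N → Fin d) (Fin N → Fin d) ℂ) S =
      (d ^ (N - S.card) : ℂ) • 1 := by
  ext u v
  simp [reduceMatrix, Matrix.one_apply, mergeFn_left_inj, Fintype.card_subtype_compl]

theorem stmt_7 (N m k : ℕ) (hN : 1 ≤ N) (hm : 1 ≤ m) (hk : k < N)
    (a : Fin m → Fin N → ZMod 2 × ZMod 2)
    (hcomm : ∀ i i' : Fin m, Even (anticommCount (a i) (a i')))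
    (hindep : ∀ ε : Fin m → ZMod 2, ε ≠ 0 → (∑ i, ε i • a i) ≠ 0)
    (hzeros : ∀ ε : Fin m → ZMod 2, ε ≠ 0 →
      (Finset.univ.filter fun j => (∑ i, ε i • a i) j = 0).card ≤ N - k - 1)
    (ρ : Matrix (Fin N → Fin 2) (Fin N → Fin 2) ℂ)
    (hρ : ρ = (2 ^ N : ℂ)⁻¹ • (List.ofFn fun i => 1 + pauliWord (a i)).prod) :
    ∀ S : Finset (Fin N), S.card = k → reduceMatrix ρ S = (2 ^ k : ℂ)⁻¹ • 1 := by
  rintro S rfl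
  have hker : Submodule.span ℂ
      {M | ∃ ε : Fin m → ZMod 2, ε ≠ 0 ∧ M = pauliWord (∑ i, ε i • a i)} ≤
        LinearMap.ker (reduceMatrixLinear N 2 S) := by
    refine Submodule.span_le.2 ?_
    rintro _ ⟨ε, hε, rfl⟩
    obtain ⟨j, hj, hb⟩ : ∃ j ∉ S, (∑ i, ε i • a i) j ≠ 0 := by
      by_contra! h
      have hle : Sᶜ.card ≤
          (Finset.univ.filter fun j => (∑ i, ε i • a i) j = 0).card :=
        Finset.card_le_card fun j hj => by simpa using h j (Finset.mem_compl.1 hj)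
      have hcard := hzeros ε hε
      rw [Finset.card_compl, Fintype.card_fin] at hle
      omega
    exact reduceMatrix_pauliWord_eq_zero hj hb
  have hprod := hker (prod_one_add_pauliWord_sub_one_mem_span a)
  rw [LinearMap.mem_ker, map_sub, sub_eq_zero] at hprod
  have hone : reduceMatrixLinear N 2 S 1 = (2 ^ (N - S.card) : ℂ) • 1 := by
    exact_mod_cast reduceMatrix_one (d := 2) S
  change reduceMatrixLinear N 2 S ρ = _
  rw [hρ, map_smul, hprod, hone, smul_smul]
  congr 1
  rw [pow_sub₀ (2 : ℂ) two_ne_zero hk.le, inv_mul_cancel_left₀ (pow_ne_zero _ two_ne_zero)]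
end
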